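/- Let φ, ψ : U^n → U^n be holomorphic, suppose the difference of composition operators C_φ − C_ψ : B → H^∞ is bounded, and fix 1 ≤ l ≤ n. For δ > 0 let E_δ^l = {z ∈ U^n : max(|φ_l(z)|, |ψ_l(z)|) > 1 − δ}. Then for every compact linear operator K : B → H^∞, ‖C_φ − C_ψ − K‖ ≥ (1/4) · lim_{δ→0⁺} sup_{z∈E_δ^l} |φ_l(z) − ψ_l(z)| / |1 − \overline{φ_l(z)} ψ_l(z)|. -/

import Mathlib

open Complex Metric Set Filter
open scoped Topology BigOperators

noncomputable section

/-- The unit polydisc `U^n` in `ℂ^n`; the norm on `Fin n → ℂ` is the sup norm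
`|||z||| = max_j |z_j|`. -/
def polyDisc (n : ℕ) : Set (Fin n → ℂ) := {z | ‖z‖ < 1}

/-- `Σ_{j=1}^n (1 - |z_j|²) |∂f/∂z_j(z)|`. -/
def blochSum (n : ℕ) (f : (Fin n → ℂ) → ℂ) (z : Fin n → ℂ) : ℝ :=
  ∑ j : Fin n, (1 - ‖z j‖ ^ 2) * ‖fderiv ℂ f z (Pi.single j 1)‖

/-- The Bloch norm `‖f‖ = |f(0)| + sup_{z ∈ Uⁿ} Σ_j (1-|z_j|²)|∂f/∂z_j(z)|`. -/
def blochNorm (n : ℕ) (f : (Fin n → ℂ) → ℂ) : ℝ :=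
  ‖f 0‖ + sSup (blochSum n f '' polyDisc n)

/-- Membership in the Bloch space of `Uⁿ`: holomorphic on `Uⁿ` with finite Bloch norm. -/
def InBloch (n : ℕ) (f : (Fin n → ℂ) → ℂ) : Prop :=
  DifferentiableOn ℂ f (polyDisc n) ∧ BddAbove (blochSum n f '' polyDisc n)

/-- The Möbius automorphism `φ_a` of the polydisc:
`φ_a(w)_j = (w_j - a_j)/(1 - conj(a_j) w_j)`. -/
def mobius (n : ℕ) (a w : Fin n → ℂ) : Fin n → ℂ :=
  fun j => (w j - a j) / (1 - (starRingEnd ℂ) (a j) * w j)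

/-- The Kobayashi distance on the polydisc:
`k_{Uⁿ}(z,w) = (1/2) log((1 + |||φ_z(w)|||)/(1 - |||φ_z(w)|||))`. -/
def kobayashi (n : ℕ) (z w : Fin n → ℂ) : ℝ :=
  (1 / 2) * Real.log ((1 + ‖mobius n z w‖) / (1 - ‖mobius n z w‖))

/-- The `H^∞` (sup) norm of `g` over the polydisc: `‖g‖_∞ = sup_{z ∈ Uⁿ} |g(z)|`. -/
def supNorm (n : ℕ) (g : (Fin n → ℂ) → ℂ) : ℝ :=
  ⨆ z : polyDisc n, ‖g (z : Fin n → ℂ)‖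

/-- The difference of composition operators `C_φ - C_ψ : f ↦ f∘φ - f∘ψ`. -/
def compOpDiff (n : ℕ) (φ ψ : (Fin n → ℂ) → Fin n → ℂ) :
    ((Fin n → ℂ) → ℂ) → (Fin n → ℂ) → ℂ :=
  fun f => f ∘ φ - f ∘ ψ

/-- Boundedness of an operator from the Bloch space to `H^∞`. -/
def IsBddOp (n : ℕ) (T : ((Fin n → ℂ) → ℂ) → (Fin n → ℂ) → ℂ) : Prop :=
  ∃ C : ℝ, ∀ f, InBloch n f → supNorm n (T f) ≤ C * blochNorm n f

/-- The operator norm of `T` from the Bloch space to `H^∞`: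
the supremum of `‖T f‖_∞` over the unit ball of the Bloch space. -/
def opNorm (n : ℕ) (T : ((Fin n → ℂ) → ℂ) → (Fin n → ℂ) → ℂ) : ℝ :=
  sSup {t : ℝ | ∃ f, InBloch n f ∧ blochNorm n f ≤ 1 ∧ t = supNorm n (T f)}

/-- `T` is linear on the Bloch space (values only matter on the polydisc). -/
def IsLinOp (n : ℕ) (T : ((Fin n → ℂ) → ℂ) → (Fin n → ℂ) → ℂ) : Prop :=
  (∀ f g, InBloch n f → InBloch n g →
    ∀ z ∈ polyDisc n, T (f + g) z = T f z + T g z) ∧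
  (∀ (c : ℂ) (f), InBloch n f → ∀ z ∈ polyDisc n, T (c • f) z = c * T f z)

/-- `T` sends Bloch functions to `H^∞` functions (bounded and holomorphic on `Uⁿ`). -/
def MapsToHinf (n : ℕ) (T : ((Fin n → ℂ) → ℂ) → (Fin n → ℂ) → ℂ) : Prop :=
  ∀ f, InBloch n f → DifferentiableOn ℂ (T f) (polyDisc n) ∧
    BddAbove ((fun z => ‖T f z‖) '' polyDisc n)

/-- Compactness of a linear operator `T` from the Bloch space to `H^∞`:
every sequence in the unit ball of the Bloch space has a subsequence whose image
under `T` is Cauchy in the `H^∞` norm. -/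
def IsCompactOp (n : ℕ) (T : ((Fin n → ℂ) → ℂ) → (Fin n → ℂ) → ℂ) : Prop :=
  IsLinOp n T ∧ MapsToHinf n T ∧
  ∀ F : ℕ → (Fin n → ℂ) → ℂ, (∀ m, InBloch n (F m) ∧ blochNorm n (F m) ≤ 1) →
    ∃ s : ℕ → ℕ, StrictMono s ∧
      ∀ ε : ℝ, 0 < ε → ∃ N : ℕ, ∀ k ≥ N, ∀ k' ≥ N,
        supNorm n (T (F (s k)) - T (F (s k'))) ≤ ε

/-- The essential norm of `T : B → H^∞`: the distance from `T` to the compact operators,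
`‖T‖_e = inf {‖T - K‖ : K compact}`. -/
def essNorm (n : ℕ) (T : ((Fin n → ℂ) → ℂ) → (Fin n → ℂ) → ℂ) : ℝ :=
  sInf {t : ℝ | ∃ K, IsCompactOp n K ∧ t = opNorm n (T - K)}

/-- `E_δ = {z ∈ Uⁿ : max(|||φ(z)|||, |||ψ(z)|||) > 1 - δ}`. -/
def Eset (n : ℕ) (φ ψ : (Fin n → ℂ) → Fin n → ℂ) (δ : ℝ) : Set (Fin n → ℂ) :=
  {z ∈ polyDisc n | 1 - δ < max ‖φ z‖ ‖ψ z‖}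

/-- `E_δ^l = {z ∈ Uⁿ : max(|φ_l(z)|, |ψ_l(z)|) > 1 - δ}`. -/
def EsetCoord (n : ℕ) (φ ψ : (Fin n → ℂ) → Fin n → ℂ) (l : Fin n) (δ : ℝ) :
    Set (Fin n → ℂ) :=
  {z ∈ polyDisc n | 1 - δ < max ‖φ z l‖ ‖ψ z l‖}

lemma isOpen_polyDisc (n : ℕ) : IsOpen (polyDisc n) :=
  isOpen_lt continuous_norm continuous_const

lemma zero_mem_polyDisc (n : ℕ) : (0 : Fin n → ℂ) ∈ polyDisc n := by
  simp [polyDisc]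

lemma norm_coord_lt_one {n : ℕ} {z : Fin n → ℂ} (hz : z ∈ polyDisc n) (j : Fin n) :
    ‖z j‖ < 1 :=
  (norm_le_pi_norm z j).trans_lt hz

lemma blochSum_nonneg {n : ℕ} (f : (Fin n → ℂ) → ℂ) {z : Fin n → ℂ} (hz : z ∈ polyDisc n) :
    0 ≤ blochSum n f z := by
  refine Finset.sum_nonneg fun j _ => mul_nonneg ?_ (norm_nonneg _)
  have := norm_coord_lt_one hz j
  nlinarith [norm_nonneg (z j)]

lemma blochNorm_nonneg (n : ℕ) (f : (Fin n → ℂ) → ℂ) : 0 ≤ blochNorm n f := by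
  refine add_nonneg (norm_nonneg _) (Real.sSup_nonneg ?_)
  rintro _ ⟨z, hz, rfl⟩
  exact blochSum_nonneg f hz

lemma InBloch.blochSum_le {n : ℕ} {f : (Fin n → ℂ) → ℂ} (hf : InBloch n f)
    {z : Fin n → ℂ} (hz : z ∈ polyDisc n) :
    blochSum n f z ≤ sSup (blochSum n f '' polyDisc n) :=
  le_csSup hf.2 (mem_image_of_mem _ hz)

lemma inBloch_of_blochSum_le {n : ℕ} {f : (Fin n → ℂ) → ℂ}
    (hf : DifferentiableOn ℂ f (polyDisc n)) {c : ℝ}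
    (h : ∀ z ∈ polyDisc n, blochSum n f z ≤ c) :
    InBloch n f ∧ blochNorm n f ≤ ‖f 0‖ + c := by
  refine ⟨⟨hf, c, ?_⟩, add_le_add_right (csSup_le ⟨_, mem_image_of_mem _ (zero_mem_polyDisc n)⟩ ?_) _⟩
  all_goals
    rintro _ ⟨z, hz, rfl⟩
    exact h z hz

lemma InBloch.add {n : ℕ} {f g : (Fin n → ℂ) → ℂ} (hf : InBloch n f) (hg : InBloch n g) :
    InBloch n (f + g) ∧ blochNorm n (f + g) ≤ blochNorm n f + blochNorm n g := by
  have key := inBloch_of_blochSum_le (hf.1.add hg.1)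
    (c := sSup (blochSum n f '' polyDisc n) + sSup (blochSum n g '' polyDisc n)) ?_
  · refine ⟨key.1, key.2.trans ?_⟩
    have := norm_add_le (f 0) (g 0)
    simp only [blochNorm, Pi.add_apply]
    linarith
  · intro z hz
    refine le_trans ?_ (add_le_add (hf.blochSum_le hz) (hg.blochSum_le hz))
    have hfz := hf.1.differentiableAt ((isOpen_polyDisc n).mem_nhds hz)
    have hgz := hg.1.differentiableAt ((isOpen_polyDisc n).mem_nhds hz)
    simp only [blochSum, fderiv_add hfz hgz, ← Finset.sum_add_distrib, ← mul_add]
    refine Finset.sum_le_sum fun j _ => mul_le_mul_of_nonneg_left (norm_add_le _ _) ?_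
    have := norm_coord_lt_one hz j
    nlinarith [norm_nonneg (z j)]

lemma InBloch.smul {n : ℕ} {f : (Fin n → ℂ) → ℂ} (hf : InBloch n f) (c : ℂ) :
    InBloch n (c • f) ∧ blochNorm n (c • f) ≤ ‖c‖ * blochNorm n f := by
  have key := inBloch_of_blochSum_le (hf.1.const_smul c)
    (c := ‖c‖ * sSup (blochSum n f '' polyDisc n)) ?_
  · refine ⟨key.1, key.2.trans ?_⟩
    simp only [blochNorm, Pi.smul_apply, norm_smul, mul_add, le_refl]
  · intro z hz
    refine le_trans ?_ (mul_le_mul_of_nonneg_left (hf.blochSum_le hz) (norm_nonneg c))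
    have hfz := hf.1.differentiableAt ((isOpen_polyDisc n).mem_nhds hz)
    simp only [blochSum, fderiv_const_smul hfz, Finset.mul_sum]
    refine Finset.sum_le_sum fun j _ => ?_
    simp only [_root_.smul_apply, norm_smul]
    exact le_of_eq (by ring)

lemma supNorm_nonneg (n : ℕ) (g : (Fin n → ℂ) → ℂ) : 0 ≤ supNorm n g :=
  Real.iSup_nonneg fun _ => norm_nonneg _

/-- Genuine boundedness on the polydisc, under which `supNorm` is not a junk value. -/
def BddOnDisc (n : ℕ) (g : (Fin n → ℂ) → ℂ) : Prop :=
  BddAbove (range fun z : polyDisc n => ‖g (z : Fin n → ℂ)‖)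

lemma BddOnDisc.of_le {n : ℕ} {g : (Fin n → ℂ) → ℂ} {c : ℝ}
    (h : ∀ z ∈ polyDisc n, ‖g z‖ ≤ c) : BddOnDisc n g :=
  ⟨c, by rintro _ ⟨z, rfl⟩; exact h z z.2⟩

lemma BddOnDisc.norm_le {n : ℕ} {g : (Fin n → ℂ) → ℂ} (hg : BddOnDisc n g)
    {z : Fin n → ℂ} (hz : z ∈ polyDisc n) : ‖g z‖ ≤ supNorm n g :=
  le_ciSup hg (⟨z, hz⟩ : polyDisc n)

lemma supNorm_le {n : ℕ} {g : (Fin n → ℂ) → ℂ} {c : ℝ}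
    (h : ∀ z ∈ polyDisc n, ‖g z‖ ≤ c) : supNorm n g ≤ c :=
  haveI : Nonempty (polyDisc n) := ⟨⟨0, zero_mem_polyDisc n⟩⟩
  ciSup_le fun z => h z z.2

lemma BddOnDisc.sub {n : ℕ} {f g : (Fin n → ℂ) → ℂ} (hf : BddOnDisc n f)
    (hg : BddOnDisc n g) : BddOnDisc n (f - g) :=
  .of_le fun _ hz => (norm_sub_le _ _).trans (add_le_add (hf.norm_le hz) (hg.norm_le hz))

lemma MapsToHinf.bddOnDisc {n : ℕ} {T : ((Fin n → ℂ) → ℂ) → (Fin n → ℂ) → ℂ}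
    (hT : MapsToHinf n T) {f : (Fin n → ℂ) → ℂ} (hf : InBloch n f) : BddOnDisc n (T f) := by
  obtain ⟨c, hc⟩ := (hT f hf).2
  exact .of_le fun z hz => hc (mem_image_of_mem (fun z => ‖T f z‖) hz)

lemma IsCompactOp.exists_supNorm_le {n : ℕ} {K : ((Fin n → ℂ) → ℂ) → (Fin n → ℂ) → ℂ}
    (hK : IsCompactOp n K) :
    ∃ M : ℝ, ∀ f, InBloch n f → blochNorm n f ≤ 1 → supNorm n (K f) ≤ M := by
  by_contra! h
  choose F hF hF1 hFM using fun m : ℕ => h m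
  obtain ⟨s, hs, hC⟩ := hK.2.2 F fun m => ⟨hF m, hF1 m⟩
  obtain ⟨N, hN⟩ := hC 1 one_pos
  obtain ⟨k, hk⟩ := exists_nat_ge (supNorm n (K (F (s N))) + 1)
  have hbd := fun m => hK.2.1.bddOnDisc (hF m)
  have hle : supNorm n (K (F (s (max k N)))) ≤ supNorm n (K (F (s N))) + 1 := by
    refine supNorm_le fun z hz => ?_
    have h1 := (((hbd (s (max k N))).sub (hbd (s N))).norm_le hz).trans
      (hN _ (le_max_right k N) N le_rfl)
    have h2 := (hbd (s N)).norm_le hz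
    have h3 := norm_sub_norm_le (K (F (s (max k N))) z) (K (F (s N)) z)
    simp only [Pi.sub_apply] at h1
    linarith
  have hk' : (k : ℝ) ≤ s (max k N) := by
    exact_mod_cast (le_max_left k N).trans hs.le_apply
  linarith [hFM (s (max k N))]

/-- A compact perturbation of a bounded operator has its `opNorm` set bounded above, even where
the unperturbed operator takes unbounded values. -/
lemma IsBddOp.bddAbove_sub_compact {n : ℕ} {T K : ((Fin n → ℂ) → ℂ) → (Fin n → ℂ) → ℂ}
    (hT : IsBddOp n T) (hK : IsCompactOp n K) :
    BddAbove {t : ℝ | ∃ f, InBloch n f ∧ blochNorm n f ≤ 1 ∧ t = supNorm n ((T - K) f)} := by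
  obtain ⟨C, hC⟩ := hT
  obtain ⟨M, hM⟩ := hK.exists_supNorm_le
  refine ⟨|C| + |M|, ?_⟩
  rintro _ ⟨f, hf, hf1, rfl⟩
  have hKf := hK.2.1.bddOnDisc hf
  by_cases hb : BddOnDisc n ((T - K) f)
  · have hTf : BddOnDisc n (T f) := by
      refine .of_le (c := supNorm n ((T - K) f) + supNorm n (K f)) fun z hz => ?_
      have := norm_add_le ((T - K) f z) (K f z)
      simp only [Pi.sub_apply, sub_add_cancel] at this
      exact this.trans (add_le_add (hb.norm_le hz) (hKf.norm_le hz))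
    have hTC : supNorm n (T f) ≤ |C| :=
      (hC f hf).trans <| (mul_le_mul_of_nonneg_right (le_abs_self C) (blochNorm_nonneg n f)).trans
        (mul_le_of_le_one_right (abs_nonneg C) hf1)
    refine supNorm_le fun z hz => (norm_sub_le _ _).trans (add_le_add ?_ ?_)
    · exact (hTf.norm_le hz).trans hTC
    · exact (hKf.norm_le hz).trans ((hM f hf hf1).trans (le_abs_self M))
  · rw [supNorm, Real.iSup_of_not_bddAbove hb]
    positivity

/-- The test function `w ↦ (1 - |a|²) w_l / (1 - conj(a) w_l)`: up to sign and an additive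
constant, the Möbius map exchanging `0` and `a` in the `l`-th coordinate. -/
def blochTest (n : ℕ) (l : Fin n) (a : ℂ) (w : Fin n → ℂ) : ℂ :=
  (1 - (‖a‖ : ℂ) ^ 2) * w l / (1 - (starRingEnd ℂ) a * w l)

lemma one_sub_norm_le_norm_one_sub_conj_mul {a z : ℂ} (ha : ‖a‖ < 1) :
    1 - ‖z‖ ≤ ‖1 - (starRingEnd ℂ) a * z‖ := by
  have h1 := norm_sub_norm_le 1 ((starRingEnd ℂ) a * z)
  rw [norm_mul, norm_one, RCLike.norm_conj] at h1
  nlinarith [norm_nonneg z]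

lemma one_sub_conj_mul_ne_zero {a z : ℂ} (ha : ‖a‖ < 1) (hz : ‖z‖ < 1) :
    1 - (starRingEnd ℂ) a * z ≠ 0 :=
  norm_pos_iff.1 ((sub_pos.2 hz).trans_le (one_sub_norm_le_norm_one_sub_conj_mul ha))

lemma one_sub_sq_mul_one_sub_sq_le (a z : ℂ) :
    (1 - ‖a‖ ^ 2) * (1 - ‖z‖ ^ 2) ≤ ‖1 - (starRingEnd ℂ) a * z‖ ^ 2 := by
  simp only [← Complex.normSq_eq_norm_sq, Complex.normSq_apply, Complex.sub_re, Complex.sub_im,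
    Complex.mul_re, Complex.mul_im, Complex.conj_re, Complex.conj_im, Complex.one_re,
    Complex.one_im]
  nlinarith [sq_nonneg (a.re - z.re), sq_nonneg (a.im - z.im)]

lemma norm_one_sub_norm_sq {a : ℂ} (ha : ‖a‖ < 1) :
    ‖(1 - (‖a‖ : ℂ) ^ 2)‖ = 1 - ‖a‖ ^ 2 := by
  rw [show (1 - (‖a‖ : ℂ) ^ 2) = ((1 - ‖a‖ ^ 2 : ℝ) : ℂ) by push_cast; rfl, Complex.norm_real,
    Real.norm_eq_abs, abs_of_nonneg]
  nlinarith [norm_nonneg a]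

lemma hasFDerivAt_blochTest {n : ℕ} (l : Fin n) {a : ℂ} (ha : ‖a‖ < 1) {w : Fin n → ℂ}
    (hw : w ∈ polyDisc n) :
    HasFDerivAt (blochTest n l a)
      (((1 - (‖a‖ : ℂ) ^ 2) / (1 - (starRingEnd ℂ) a * w l) ^ 2) •
        (ContinuousLinearMap.proj l : (Fin n → ℂ) →L[ℂ] ℂ)) w := by
  have hne := one_sub_conj_mul_ne_zero ha (norm_coord_lt_one hw l)
  have h1 : HasDerivAt (fun z : ℂ => (1 - (‖a‖ : ℂ) ^ 2) * z / (1 - (starRingEnd ℂ) a * z))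
      ((1 - (‖a‖ : ℂ) ^ 2) / (1 - (starRingEnd ℂ) a * w l) ^ 2) (w l) := by
    refine (((hasDerivAt_id' (w l)).const_mul (1 - (‖a‖ : ℂ) ^ 2)).fun_div
      (((hasDerivAt_id' (w l)).const_mul ((starRingEnd ℂ) a)).const_sub 1) hne).congr_deriv ?_
    ring
  exact h1.comp_hasFDerivAt w
    (ContinuousLinearMap.proj (R := ℂ) (φ := fun _ : Fin n => ℂ) l).hasFDerivAt

lemma inBloch_blochTest {n : ℕ} (l : Fin n) {a : ℂ} (ha : ‖a‖ < 1) :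
    InBloch n (blochTest n l a) ∧ blochNorm n (blochTest n l a) ≤ 1 := by
  have key := inBloch_of_blochSum_le (f := blochTest n l a) (c := 1)
    (fun w hw => (hasFDerivAt_blochTest l ha hw).differentiableAt.differentiableWithinAt) ?_
  · simpa [blochTest] using key
  · intro w hw
    have hne := one_sub_conj_mul_ne_zero ha (norm_coord_lt_one hw l)
    rw [blochSum, (hasFDerivAt_blochTest l ha hw).fderiv, Finset.sum_eq_single l]
    · simp only [_root_.smul_apply, ContinuousLinearMap.proj_apply,
        Pi.single_eq_same, smul_eq_mul, mul_one, norm_div, norm_pow, norm_one_sub_norm_sq ha]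
      rw [← mul_div_assoc, div_le_one (by positivity), mul_comm]
      exact one_sub_sq_mul_one_sub_sq_le a (w l)
    · intro j _ hj
      simp [Pi.single_eq_of_ne hj.symm]
    · simp

lemma norm_blochTest_le {n : ℕ} (l : Fin n) {a : ℂ} (ha : ‖a‖ < 1) {w : Fin n → ℂ}
    (hw : w ∈ polyDisc n) : ‖blochTest n l a w‖ ≤ 2 * (1 - ‖a‖) / (1 - ‖w l‖) := by
  have hwl := norm_coord_lt_one hw l
  rw [blochTest, norm_div, norm_mul, norm_one_sub_norm_sq ha]
  refine div_le_div₀ (by linarith) ?_ (sub_pos.2 hwl) (one_sub_norm_le_norm_one_sub_conj_mul ha)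
  nlinarith [norm_nonneg a, norm_nonneg (w l), mul_nonneg (sub_nonneg.2 ha.le) (norm_nonneg a)]

lemma norm_blochTest_le_two {n : ℕ} (l : Fin n) {a : ℂ} (ha : ‖a‖ < 1) {w : Fin n → ℂ}
    (hw : w ∈ polyDisc n) : ‖blochTest n l a w‖ ≤ 2 := by
  have hwl := norm_coord_lt_one hw l
  have hne := one_sub_conj_mul_ne_zero ha hwl
  have h := norm_sub_norm_le 1 ((starRingEnd ℂ) a * w l)
  rw [norm_mul, norm_one, RCLike.norm_conj] at h
  rw [blochTest, norm_div, norm_mul, norm_one_sub_norm_sq ha, div_le_iff₀ (norm_pos_iff.2 hne)]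
  nlinarith [norm_nonneg a, norm_nonneg (w l), mul_nonneg (sub_nonneg.2 ha.le) (norm_nonneg a),
    mul_nonneg (sub_nonneg.2 hwl.le) (norm_nonneg a)]

lemma blochTest_sub_blochTest {n : ℕ} (l : Fin n) {p q : Fin n → ℂ} (hp : p ∈ polyDisc n)
    (hq : q ∈ polyDisc n) :
    blochTest n l (p l) p - blochTest n l (p l) q =
      (p l - q l) / (1 - (starRingEnd ℂ) (p l) * q l) := by
  have hpl := norm_coord_lt_one hp l
  have hpp := one_sub_conj_mul_ne_zero hpl hpl
  have hpq := one_sub_conj_mul_ne_zero hpl (norm_coord_lt_one hq l)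
  rw [blochTest, blochTest, ← Complex.conj_mul']
  field_simp
  ring

lemma norm_one_sub_conj_mul_comm (a b : ℂ) :
    ‖1 - (starRingEnd ℂ) a * b‖ = ‖1 - (starRingEnd ℂ) b * a‖ := by
  rw [← RCLike.norm_conj (1 - (starRingEnd ℂ) a * b)]
  simp [mul_comm]

/-- One of the two test functions based at `p l`, `q l` lies near the boundary when `p` or `q`
does, and separates `p` from `q` by the pseudo-hyperbolic distance of their coordinates. -/
lemma exists_blochTest_separating {n : ℕ} (l : Fin n) {p q : Fin n → ℂ} (hp : p ∈ polyDisc n)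
    (hq : q ∈ polyDisc n) :
    ∃ a : ℂ, ‖a‖ < 1 ∧ ‖a‖ = max ‖p l‖ ‖q l‖ ∧
      ‖blochTest n l a p - blochTest n l a q‖ =
        ‖p l - q l‖ / ‖1 - (starRingEnd ℂ) (p l) * q l‖ := by
  rcases le_total ‖q l‖ ‖p l‖ with h | h
  · refine ⟨p l, norm_coord_lt_one hp l, (max_eq_left h).symm, ?_⟩
    rw [blochTest_sub_blochTest l hp hq, norm_div]
  · refine ⟨q l, norm_coord_lt_one hq l, (max_eq_right h).symm, ?_⟩
    rw [norm_sub_rev, blochTest_sub_blochTest l hq hp, norm_div, norm_sub_rev,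
      norm_one_sub_conj_mul_comm]

lemma tendsto_blochTest {n : ℕ} (l : Fin n) {a : ℕ → ℂ} (ha : ∀ m, ‖a m‖ < 1)
    (ha1 : Tendsto (fun m => ‖a m‖) atTop (𝓝 1)) {w : Fin n → ℂ} (hw : w ∈ polyDisc n) :
    Tendsto (fun m => blochTest n l (a m) w) atTop (𝓝 0) := by
  refine squeeze_zero_norm (fun m => norm_blochTest_le l (ha m) hw) ?_
  simpa using ((ha1.const_sub 1).const_mul 2).div_const (1 - ‖w l‖)

/-- If test functions based at points tending to the boundary separate `φ (z m)` from `ψ (z m)`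
by at least `c`, then every compact perturbation of `C_φ - C_ψ` has norm at least `c / 2`. -/
lemma half_le_opNorm_diff_sub_compact {n : ℕ} {φ ψ : (Fin n → ℂ) → Fin n → ℂ}
    (hφm : MapsTo φ (polyDisc n) (polyDisc n)) (hψm : MapsTo ψ (polyDisc n) (polyDisc n))
    (hbdd : IsBddOp n (compOpDiff n φ ψ)) (l : Fin n)
    {K : ((Fin n → ℂ) → ℂ) → (Fin n → ℂ) → ℂ} (hK : IsCompactOp n K)
    {z : ℕ → Fin n → ℂ} (hz : ∀ m, z m ∈ polyDisc n) {a : ℕ → ℂ} (ha : ∀ m, ‖a m‖ < 1)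
    (ha1 : Tendsto (fun m => ‖a m‖) atTop (𝓝 1)) {c : ℝ}
    (hc : ∀ m, c ≤ ‖blochTest n l (a m) (φ (z m)) - blochTest n l (a m) (ψ (z m))‖) :
    c / 2 ≤ opNorm n (compOpDiff n φ ψ - K) := by
  have hF := fun m => inBloch_blochTest l (ha m)
  obtain ⟨s, hs, hC⟩ := hK.2.2 (fun m => blochTest n l (a m)) hF
  refine le_of_forall_pos_le_add fun ε hε => ?_
  obtain ⟨N, hN⟩ := hC ε hε
  set x := z (s N)
  have hx : x ∈ polyDisc n := hz _
  have hlim := (((tendsto_blochTest l ha ha1 (hφm hx)).sub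
    (tendsto_blochTest l ha ha1 (hψm hx))).norm.comp hs.tendsto_atTop)
  rw [sub_zero, norm_zero] at hlim
  obtain ⟨k, hkε, hkN⟩ := ((hlim.eventually_lt_const hε).and (eventually_ge_atTop N)).exists
  simp only [Function.comp_apply] at hkε
  set f := blochTest n l (a (s N))
  set g := blochTest n l (a (s k))
  have hf : InBloch n f ∧ blochNorm n f ≤ 1 := hF _
  have hg : InBloch n g ∧ blochNorm n g ≤ 1 := hF _
  have hng := hg.1.smul (-1)
  have hfg := hf.1.add hng.1
  have hh := hfg.1.smul (1 / 2)
  set h : (Fin n → ℂ) → ℂ := (1 / 2 : ℂ) • (f + (-1 : ℂ) • g) with h_def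
  have hval (w : Fin n → ℂ) : h w = 1 / 2 * (f w - g w) := by
    simp only [h_def, Pi.smul_apply, Pi.add_apply, smul_eq_mul]
    ring
  have hh1 : blochNorm n h ≤ 1 := by
    have h1 := hng.2
    have h2 := hfg.2
    have h3 := hh.2
    rw [norm_neg, norm_one, one_mul] at h1
    rw [norm_div, norm_one, Complex.norm_ofNat] at h3
    linarith [hf.2, hg.2]
  have hTh : BddOnDisc n (compOpDiff n φ ψ h) := by
    have hhb : ∀ w ∈ polyDisc n, ‖h w‖ ≤ 2 := by
      intro w hw
      have h1 : ‖f w‖ ≤ 2 := norm_blochTest_le_two l (ha _) hw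
      have h2 : ‖g w‖ ≤ 2 := norm_blochTest_le_two l (ha _) hw
      rw [hval, norm_mul, norm_div, norm_one, Complex.norm_ofNat]
      linarith [norm_sub_le (f w) (g w)]
    exact .of_le fun w hw =>
      (norm_sub_le _ _).trans (add_le_add (hhb _ (hφm hw)) (hhb _ (hψm hw)))
  have hle : ‖(compOpDiff n φ ψ - K) h x‖ ≤ opNorm n (compOpDiff n φ ψ - K) :=
    ((hTh.sub (hK.2.1.bddOnDisc hh.1)).norm_le hx).trans
      (le_csSup (hbdd.bddAbove_sub_compact hK) ⟨h, hh.1, hh1, rfl⟩)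
  have hKx : ‖K f x - K g x‖ ≤ ε :=
    (((hK.2.1.bddOnDisc hf.1).sub (hK.2.1.bddOnDisc hg.1)).norm_le hx).trans
      (hN N le_rfl k hkN)
  have hKh : K h x = 1 / 2 * (K f x - K g x) := by
    rw [h_def, hK.1.2 _ _ hfg.1 x hx, hK.1.1 _ _ hf.1 hng.1 x hx, hK.1.2 _ _ hg.1 x hx]
    ring
  have hsplit : f (φ x) - f (ψ x) =
      2 * (compOpDiff n φ ψ - K) h x + ((K f x - K g x) + (g (φ x) - g (ψ x))) := by
    simp only [Pi.sub_apply, hKh, compOpDiff, Function.comp_apply, hval]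
    ring
  have hcx : c ≤ ‖f (φ x) - f (ψ x)‖ := hc _
  rw [hsplit] at hcx
  have h1 := norm_add_le (2 * (compOpDiff n φ ψ - K) h x)
    ((K f x - K g x) + (g (φ x) - g (ψ x)))
  have h2 := norm_add_le (K f x - K g x) (g (φ x) - g (ψ x))
  rw [norm_mul, Complex.norm_ofNat] at h1
  linarith

/-- Let `φ, ψ : Uⁿ → Uⁿ` be holomorphic with `C_φ - C_ψ : B → H^∞`
bounded, and fix a coordinate `l`.  Then for every compact linear operator `K : B → H^∞`,
`‖C_φ - C_ψ - K‖ ≥ (1/4) lim_{δ→0⁺} sup_{z ∈ E_δ^l} |φ_l(z) - ψ_l(z)|/|1 - conj(φ_l(z)) ψ_l(z)|`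
(the limit equals the infimum over `δ > 0`, the supremum being monotone in `δ`). -/
theorem opNorm_diff_sub_compact_ge (n : ℕ)
    (φ ψ : (Fin n → ℂ) → Fin n → ℂ)
    (hφ : DifferentiableOn ℂ φ (polyDisc n)) (hφm : MapsTo φ (polyDisc n) (polyDisc n))
    (hψ : DifferentiableOn ℂ ψ (polyDisc n)) (hψm : MapsTo ψ (polyDisc n) (polyDisc n))
    (hbdd : IsBddOp n (compOpDiff n φ ψ)) (l : Fin n)
    (K : ((Fin n → ℂ) → ℂ) → (Fin n → ℂ) → ℂ) (hK : IsCompactOp n K) :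
    (1 / 4 : ℝ) *
        (⨅ δ : {d : ℝ // 0 < d},
          sSup ((fun z => ‖φ z l - ψ z l‖ / ‖1 - (starRingEnd ℂ) (φ z l) * ψ z l‖) ''
            EsetCoord n φ ψ l (δ : ℝ))) ≤
      opNorm n (compOpDiff n φ ψ - K) := by
  set L := ⨅ δ : {d : ℝ // 0 < d},
    sSup ((fun z => ‖φ z l - ψ z l‖ / ‖1 - (starRingEnd ℂ) (φ z l) * ψ z l‖) ''
      EsetCoord n φ ψ l (δ : ℝ))
  have hop : 0 ≤ opNorm n (compOpDiff n φ ψ - K) := by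
    refine Real.sSup_nonneg ?_
    rintro _ ⟨f, -, -, rfl⟩
    exact supNorm_nonneg n _
  rcases le_or_gt L 0 with hL | hL
  · linarith
  have hpts : ∀ m : ℕ, ∃ z ∈ polyDisc n, ∃ a : ℂ, ‖a‖ < 1 ∧ 1 - 1 / ((m : ℝ) + 1) < ‖a‖ ∧
      L / 2 ≤ ‖blochTest n l a (φ z) - blochTest n l a (ψ z)‖ := by
    intro m
    have hlt := (half_lt_self hL).trans_le
      (ciInf_le (ι := {d : ℝ // 0 < d}) ⟨0, by
        rintro _ ⟨δ, rfl⟩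
        refine Real.sSup_nonneg ?_
        rintro _ ⟨z, -, rfl⟩
        positivity⟩ ⟨1 / ((m : ℝ) + 1), by positivity⟩)
    have hne : (EsetCoord n φ ψ l (1 / ((m : ℝ) + 1))).Nonempty := by
      by_contra hempty
      rw [not_nonempty_iff_eq_empty] at hempty
      simp only [hempty, image_empty, Real.sSup_empty] at hlt
      linarith
    obtain ⟨_, ⟨z, ⟨hz, hzδ⟩, rfl⟩, hzL⟩ := exists_lt_of_lt_csSup (hne.image _) hlt
    obtain ⟨a, ha, hamax, hasep⟩ := exists_blochTest_separating l (hφm hz) (hψm hz)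
    exact ⟨z, hz, a, ha, hamax ▸ hzδ, hasep ▸ hzL.le⟩
  choose z hz a ha ha1 hsep using hpts
  have hlim : Tendsto (fun m => ‖a m‖) atTop (𝓝 1) := by
    refine tendsto_of_tendsto_of_tendsto_of_le_of_le ?_ tendsto_const_nhds
      (fun m => (ha1 m).le) fun m => (ha m).le
    simpa using (tendsto_one_div_add_atTop_nhds_zero_nat (𝕜 := ℝ)).const_sub 1
  have := half_le_opNorm_diff_sub_compact hφm hψm hbdd l hK hz ha hlim hsep
  linarith

end
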